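/- Let λ_0, …, λ_5 be pairwise distinct complex numbers. Then Σ_{0≤i<j≤5} (λ_i + λ_j) · P_4(λ_i,λ_j) · P_5(λ_i,λ_j) / D_{ij} = 1. -/

import Mathlib

open Finset in
/-- Bott denominator: `D_{ij} = ∏_{k ≠ i,j} (λ_i − λ_k)(λ_j − λ_k)`. -/
noncomputable def bottD {n : ℕ} (l : Fin n → ℂ) (i j : Fin n) : ℂ :=
  ∏ k ∈ (Finset.univ \ {i, j}), (l i - l k) * (l j - l k)

/-- `P_c(x,y) = Σ_{t=0}^{c−1} x^t y^{c−1−t}`. -/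
noncomputable def bottP (c : ℕ) (x y : ℂ) : ℂ :=
  ∑ t ∈ Finset.range c, x ^ t * y ^ (c - 1 - t)

open Finset Polynomial in
theorem sum_pow_div_prod_sub {ι F : Type*} [Fintype ι] [DecidableEq ι] [Field F] {v : ι → F}
    (hv : Function.Injective v) {m : ℕ} (hm : m < Fintype.card ι) :
    ∑ i, v i ^ m / ∏ k ∈ univ.erase i, (v i - v k) =
      if m = Fintype.card ι - 1 then 1 else 0 := by
  have h := Lagrange.coeff_eq_sum (s := univ) (hv.injOn) (P := (X : F[X]) ^ m)
    (by rw [degree_X_pow, card_univ]; exact_mod_cast hm)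
  simpa [coeff_X_pow, eq_comm] using h.symm

theorem sum_sum_eq_two_mul_sum_filter_lt {ι R : Type*} [Fintype ι] [LinearOrder ι] [Semiring R]
    (f : ι → ι → R) (hsymm : ∀ i j, f i j = f j i) (hdiag : ∀ i, f i i = 0) :
    ∑ i, ∑ j, f i j = 2 * ∑ p ∈ Finset.univ.filter (fun p : ι × ι => p.1 < p.2), f p.1 p.2 := by
  have hsplit (i j : ι) :
      f i j = (if i < j then f i j else 0) + (if j < i then f j i else 0) := by
    rcases lt_trichotomy i j with h | rfl | h
    · simp [h, h.not_gt]
    · simp [hdiag]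
    · simp [h, h.not_gt, hsymm i j]
  rw [Finset.sum_filter, Fintype.sum_prod_type, two_mul,
    Finset.sum_congr rfl fun i _ => Finset.sum_congr rfl fun j _ => hsplit i j]
  simp only [Finset.sum_add_distrib]
  congr 1
  exact Finset.sum_comm

theorem prod_erase_mul_prod_erase_eq_bottD {n : ℕ} (l : Fin n → ℂ) {i j : Fin n} (hij : i ≠ j) :
    (∏ k ∈ Finset.univ.erase i, (l i - l k)) * ∏ k ∈ Finset.univ.erase j, (l j - l k) =
      -(l i - l j) ^ 2 * bottD l i j := by
  have hi : (Finset.univ.erase i).erase j = Finset.univ \ {i, j} := by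
    ext k; simp [and_comm]
  have hj : (Finset.univ.erase j).erase i = Finset.univ \ {i, j} := by
    ext k; simp
  rw [← Finset.mul_prod_erase (Finset.univ.erase i) _
      (Finset.mem_erase.2 ⟨hij.symm, Finset.mem_univ j⟩),
    ← Finset.mul_prod_erase (Finset.univ.erase j) _
      (Finset.mem_erase.2 ⟨hij, Finset.mem_univ i⟩),
    hi, hj, bottD, Finset.prod_mul_distrib]
  ring

theorem bottP_mul_sub (c : ℕ) (x y : ℂ) : bottP c x y * (x - y) = x ^ c - y ^ c :=
  (Commute.all x y).geom_sum₂_mul c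

theorem bottP_mul_bottP_div_bottD {n : ℕ} {l : Fin n → ℂ} (hl : Function.Injective l)
    (a b : ℕ) {i j : Fin n} (hij : i ≠ j) :
    (l i + l j) * bottP a (l i) (l j) * bottP b (l i) (l j) / bottD l i j =
      -((l i + l j) * (l i ^ a - l j ^ a) * (l i ^ b - l j ^ b)) /
        ((∏ k ∈ Finset.univ.erase i, (l i - l k)) * ∏ k ∈ Finset.univ.erase j, (l j - l k)) := by
  have hsub : l i - l j ≠ 0 := sub_ne_zero.2 (hl.ne hij)
  rw [prod_erase_mul_prod_erase_eq_bottD l hij, ← bottP_mul_sub, ← bottP_mul_sub,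
    ← mul_div_mul_left _ (bottD l i j) (neg_ne_zero.2 (pow_ne_zero 2 hsub))]
  congr 1
  ring

/-- Bott's formula for `N_1(0,0,1,1) = 1` in ℙ⁵. -/
theorem bott_sum_18 (l : Fin 6 → ℂ) (hl : Function.Injective l) :
    ∑ p ∈ Finset.univ.filter (fun p : Fin 6 × Fin 6 => p.1 < p.2),
      (l p.1 + l p.2) * bottP 4 (l p.1) (l p.2) * bottP 5 (l p.1) (l p.2) / bottD l p.1 p.2 = 1 := by
  let q : Fin 6 → ℂ := fun i => ∏ k ∈ Finset.univ.erase i, (l i - l k)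
  let S : ℕ → ℂ := fun m => ∑ i, l i ^ m / q i
  have hsum (m : ℕ) (hm : m < 6) : S m = if m = 5 then 1 else 0 := by
    simpa using sum_pow_div_prod_sub hl (m := m) (by simpa using hm)
  have hmul (a b : ℕ) : S a * S b = ∑ i, ∑ j, l i ^ a / q i * (l j ^ b / q j) :=
    Finset.sum_mul_sum ..
  let f : Fin 6 → Fin 6 → ℂ := fun i j =>
    -((l i + l j) * (l i ^ 4 - l j ^ 4) * (l i ^ 5 - l j ^ 5)) / (q i * q j)
  have hf : ∑ i, ∑ j, f i j = 2 := by
    have hexpand : ∑ i, ∑ j, f i j =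
        -(S 10 * S 0 + S 1 * S 9 + S 9 * S 1 + S 0 * S 10) +
          (S 5 * S 5 + S 6 * S 4 + S 4 * S 6 + S 5 * S 5) := by
      simp only [hmul, ← Finset.sum_add_distrib, ← Finset.sum_neg_distrib]
      refine Finset.sum_congr rfl fun i _ => Finset.sum_congr rfl fun j _ => ?_
      simp only [f]
      ring
    rw [hexpand, hsum 0 (by simp), hsum 1 (by simp), hsum 4 (by simp), hsum 5 (by simp)]
    norm_num
  rw [sum_sum_eq_two_mul_sum_filter_lt f (fun i j => by simp only [f]; ring)
    (fun i => by simp [f])] at hf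
  rw [Finset.sum_congr rfl fun p hp =>
    bottP_mul_bottP_div_bottD hl 4 5 (Finset.mem_filter.1 hp).2.ne]
  exact mul_left_cancel₀ two_ne_zero (hf.trans (mul_one 2).symm)
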